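/- arXiv:2108.02710 — 5 statements merged into one kernel-verified Lean document; each statement's English description precedes it below -/
import Mathlib

section
/- Let λ be a partition of 2j with rank r which is of Frobenius type (μ₁,…,μ_r | μ₁+1,…,μ_r+1), i.e. λ'ᵢ = λᵢ + 1 for all 1 ≤ i ≤ r. Then for every natural number s with 0 ≤ s < r, one has the strict bound ∑_{i=1}^{s} λᵢ ≤ j + s(s−1)/2 − 1. (The case s < r in the proof of Lemma 4.1.) -/
/-- Let `λ` be a partition of `2j` with rank `r` of Frobenius type
`(μ₁,…,μ_r | μ₁+1,…,μ_r+1)`, i.e. `λ'ᵢ = λᵢ + 1` for all `1 ≤ i ≤ r`.  Then for every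
`0 ≤ s < r` one has the strict bound `∑_{i=1}^{s} λᵢ ≤ j + s(s−1)/2 − 1`, stated here as
`(∑_{i=1}^{s} λᵢ) + 1 ≤ j + s(s−1)/2`.  The partition is encoded (0-indexed) as an antitone
finitely supported `f : ℕ → ℕ`, the conjugate by `g i = #{j : f j ≥ i + 1}`, the rank is
`#{i : f i ≥ i + 1}`, and the Frobenius condition reads `g i = f i + 1` for `i < r`. -/
theorem partial_sum_lt_rank_antisymmetric_type (f : ℕ → ℕ) (hanti : Antitone f)
    (hfin : (Function.support f).Finite)
    (j : ℕ) (hsum : ∑ᶠ i, f i = 2 * j)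
    (g : ℕ → ℕ) (hg : ∀ i, g i = Set.ncard {m : ℕ | i + 1 ≤ f m})
    (r : ℕ) (hr : r = Set.ncard {i : ℕ | i + 1 ≤ f i})
    (hfrob : ∀ i < r, g i = f i + 1)
    (s : ℕ) (hs : s < r) :
    (∑ i ∈ Finset.range s, f i) + 1 ≤ j + s * (s - 1) / 2 := by
  have hfs : s + 1 ≤ f s := by
    by_contra hcon
    have hsub : {i : ℕ | i + 1 ≤ f i} ⊆ ((Finset.range s : Finset ℕ) : Set ℕ) := by
      intro i hi
      simp only [Set.mem_setOf_eq] at hi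
      simp only [Finset.coe_range, Set.mem_Iio]
      by_contra h
      have := hanti (not_lt.mp h)
      omega
    have h1 := Set.ncard_le_ncard hsub (Finset.finite_toSet _)
    rw [Set.ncard_coe_finset, Finset.card_range] at h1
    omega
  obtain ⟨M, hM⟩ := hfin.bddAbove
  have hN : ∀ m, f m ≠ 0 → m < M + 1 := fun m hm => Nat.lt_succ_of_le (hM hm)
  have hsN : s < M + 1 := hN s (by omega)
  generalize M + 1 = N at hN hsN
  have hS : ∑ m ∈ Finset.range N, f m = 2 * j := by
    rw [← hsum]
    symm
    apply finsum_eq_sum_of_support_subset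
    intro m hm
    simpa using hN m hm
  have hg' : ∀ i, g i = ∑ m ∈ Finset.range N, if i + 1 ≤ f m then 1 else 0 := by
    intro i
    rw [hg, ← Finset.card_filter, ← Set.ncard_coe_finset]
    congr 1
    ext m
    simp only [Set.mem_setOf_eq, Finset.coe_filter, Finset.mem_range]
    constructor
    · intro h
      exact ⟨hN m (by omega), h⟩
    · exact fun h => h.2
  have hmin : ∀ k n : ℕ, (∑ i ∈ Finset.range k, if i + 1 ≤ n then 1 else 0) = min n k := by
    intro k n
    induction k with
    | zero => simp
    | succ k ih =>
      rw [Finset.sum_range_succ, ih]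
      split_ifs <;> omega
  have hcol : ∑ m ∈ Finset.range N, min (f m) (s + 1) = ∑ i ∈ Finset.range (s + 1), (f i + 1) := by
    calc _ = ∑ m ∈ Finset.range N, ∑ i ∈ Finset.range (s + 1), (if i + 1 ≤ f m then 1 else 0) :=
          Finset.sum_congr rfl fun m _ => (hmin _ _).symm
      _ = ∑ i ∈ Finset.range (s + 1), g i := by
          rw [Finset.sum_comm]
          exact Finset.sum_congr rfl fun i _ => (hg' i).symm
      _ = _ := Finset.sum_congr rfl fun i hi =>
          hfrob i (by have := Finset.mem_range.mp hi; omega)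
  have hsplit : ∑ m ∈ Finset.range N, f m = ∑ m ∈ Finset.range N, min (f m) (s + 1)
      + ∑ m ∈ Finset.range N, (f m - (s + 1)) := by
    rw [← Finset.sum_add_distrib]
    exact Finset.sum_congr rfl fun m _ => by omega
  have hsubset : ∑ m ∈ Finset.range s, (f m - (s + 1)) ≤
      ∑ m ∈ Finset.range N, (f m - (s + 1)) :=
    Finset.sum_le_sum_of_subset (Finset.range_mono hsN.le)
  have hrow : ∑ m ∈ Finset.range s, (f m - (s + 1)) + s * (s + 1) = ∑ m ∈ Finset.range s, f m := by
    have h2 : ∑ m ∈ Finset.range s, (s + 1) = s * (s + 1) := by simp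
    rw [← h2, ← Finset.sum_add_distrib]
    refine Finset.sum_congr rfl fun m hm => ?_
    have := hanti (Finset.mem_range.mp hm).le
    omega
  rw [Finset.sum_range_succ, Finset.sum_add_distrib] at hcol
  simp only [Finset.sum_const, Finset.card_range, smul_eq_mul, mul_one] at hcol
  have hev : 2 ∣ s * (s - 1) := (Nat.even_mul_pred_self s).two_dvd
  have hss : s * (s + 1) = s * (s - 1) + 2 * s := by
    cases s with
    | zero => rfl
    | succ n => simp only [Nat.add_sub_cancel]; ring
  omega
end

section
/- (Lemma 4.1, first part, combinatorial form.) Let λ be a partition of 2j with rank r which is of Frobenius type (μ₁,…,μ_r | μ₁+1,…,μ_r+1), i.e. λ'ᵢ = λᵢ + 1 for all 1 ≤ i ≤ r. Then for every natural number s ≥ 0, ∑_{i=1}^{s} λᵢ ≤ j + s(s−1)/2. -/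
/-- (Lemma 4.1, first part, combinatorial form.)  Let `λ` be a partition of `2j` with rank
`r` of Frobenius type `(μ₁,…,μ_r | μ₁+1,…,μ_r+1)`, i.e. `λ'ᵢ = λᵢ + 1` for all
`1 ≤ i ≤ r`.  Then for every natural number `s ≥ 0`, `∑_{i=1}^{s} λᵢ ≤ j + s(s−1)/2`.
The partition is encoded (0-indexed) as an antitone finitely supported `f : ℕ → ℕ`,
the conjugate by `g i = #{j : f j ≥ i + 1}`, the rank is `#{i : f i ≥ i + 1}`, and the
Frobenius condition reads `g i = f i + 1` for `i < r`. -/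
theorem partial_sum_bound_antisymmetric_type (f : ℕ → ℕ) (hanti : Antitone f)
    (hfin : (Function.support f).Finite)
    (j : ℕ) (hsum : ∑ᶠ i, f i = 2 * j)
    (g : ℕ → ℕ) (hg : ∀ i, g i = Set.ncard {m : ℕ | i + 1 ≤ f m})
    (r : ℕ) (hr : r = Set.ncard {i : ℕ | i + 1 ≤ f i})
    (hfrob : ∀ i < r, g i = f i + 1)
    (s : ℕ) :
    ∑ i ∈ Finset.range s, f i ≤ j + s * (s - 1) / 2 := by
  obtain ⟨N, hN, hsN⟩ : ∃ N, (∀ i, N ≤ i → f i = 0) ∧ s ≤ N := by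
    obtain ⟨B, hB⟩ := hfin.bddAbove
    refine ⟨max (B + 1) s, fun i hi => ?_, le_max_right _ _⟩
    by_contra h
    have h1 : i ≤ B := hB (Function.mem_support.mpr h)
    have h2 := le_max_left (B + 1) s
    omega
  have htot : ∑ i ∈ Finset.range N, f i = 2 * j := by
    rw [← hsum]
    symm
    apply finsum_eq_sum_of_support_subset
    intro i hi
    rw [Function.mem_support] at hi
    simp only [Finset.coe_range, Set.mem_Iio]
    by_contra h
    exact hi (hN i (by omega))
  have key : ∀ m, f m - m ≤ ((Finset.range N).filter (fun i => m < i ∧ m < f i)).card := by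
    intro m
    by_cases hm : f m ≤ m
    · omega
    have hmr : m < r := by
      have h1 : ((Finset.range (m + 1) : Finset ℕ) : Set ℕ) ⊆ {i : ℕ | i + 1 ≤ f i} := by
        intro i hi
        simp only [Finset.coe_range, Set.mem_Iio] at hi
        have h2 : f m ≤ f i := hanti (by omega)
        simp only [Set.mem_setOf_eq]
        omega
      have hf : {i : ℕ | i + 1 ≤ f i}.Finite := hfin.subset (by
        intro i hi
        simp only [Set.mem_setOf_eq] at hi
        rw [Function.mem_support]
        omega)
      have h3 := Set.ncard_le_ncard h1 hf
      rw [Set.ncard_coe_finset, Finset.card_range] at h3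
      omega
    have h1 := hfrob m hmr
    rw [hg] at h1
    have h2 : {i : ℕ | m + 1 ≤ f i} ⊆
        (((Finset.range N).filter (fun i => m < i ∧ m < f i) ∪ Finset.range (m + 1) :
          Finset ℕ) : Set ℕ) := by
      intro i hi
      simp only [Set.mem_setOf_eq] at hi
      have h4 : i < N := by
        by_contra h
        have := hN i (by omega)
        omega
      simp only [Finset.mem_coe, Finset.mem_union, Finset.mem_filter, Finset.mem_range]
      omega
    have h3 := Set.ncard_le_ncard h2 (Finset.finite_toSet _)
    rw [Set.ncard_coe_finset] at h3
    have h4 := Finset.card_union_le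
      ((Finset.range N).filter (fun i => m < i ∧ m < f i)) (Finset.range (m + 1))
    rw [Finset.card_range] at h4
    omega
  have hUL : ∑ m ∈ Finset.range N, (f m - m) ≤ ∑ i ∈ Finset.range N, min (f i) i := by
    refine (Finset.sum_le_sum fun m _ => key m).trans ?_
    simp only [Finset.card_filter]
    rw [Finset.sum_comm]
    refine Finset.sum_le_sum fun i _ => ?_
    rw [← Finset.card_filter]
    calc _ ≤ (Finset.range (min (f i) i)).card := by
          apply Finset.card_le_card
          intro m hm
          simp only [Finset.mem_filter, Finset.mem_range] at hm ⊢
          omega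
      _ = _ := Finset.card_range _
  have hsplit : ∀ n, ∑ i ∈ Finset.range n, f i =
      ∑ i ∈ Finset.range n, (f i - i) + ∑ i ∈ Finset.range n, min (f i) i := by
    intro n
    rw [← Finset.sum_add_distrib]
    exact Finset.sum_congr rfl fun i _ => by omega
  have hU : ∑ i ∈ Finset.range s, (f i - i) ≤ ∑ i ∈ Finset.range N, (f i - i) :=
    Finset.sum_le_sum_of_subset (Finset.range_subset_range.mpr hsN)
  have hL : ∑ i ∈ Finset.range s, min (f i) i ≤ s * (s - 1) / 2 := by
    rw [← Finset.sum_range_id]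
    exact Finset.sum_le_sum fun i _ => min_le_right _ _
  have h1 := hsplit N
  have h2 := hsplit s
  omega
end

section
/- Let λ be a partition of 2j with rank r which is of Frobenius type (μ₁+1,…,μ_r+1 | μ₁,…,μ_r), i.e. λᵢ = λ'ᵢ + 1 for all 1 ≤ i ≤ r. Then for every natural number s with 0 ≤ s < r, one has the strict bound ∑_{i=1}^{s} λᵢ ≤ j + s(s+1)/2 − 1. (The case s < r in the second part of the proof of Lemma 4.1.) -/
/-- Let `λ` be a partition of `2j` with rank `r` of Frobenius type
`(μ₁+1,…,μ_r+1 | μ₁,…,μ_r)`, i.e. `λᵢ = λ'ᵢ + 1` for all `1 ≤ i ≤ r`.  Then for every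
`0 ≤ s < r` one has the strict bound `∑_{i=1}^{s} λᵢ ≤ j + s(s+1)/2 − 1`, stated here as
`(∑_{i=1}^{s} λᵢ) + 1 ≤ j + s(s+1)/2`.  The partition is encoded (0-indexed) as an antitone
finitely supported `f : ℕ → ℕ`, the conjugate by `g i = #{j : f j ≥ i + 1}`, the rank is
`#{i : f i ≥ i + 1}`, and the Frobenius condition reads `f i = g i + 1` for `i < r`. -/
theorem partial_sum_lt_rank_symmetric_type (f : ℕ → ℕ) (hanti : Antitone f)
    (hfin : (Function.support f).Finite)
    (j : ℕ) (hsum : ∑ᶠ i, f i = 2 * j)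
    (g : ℕ → ℕ) (hg : ∀ i, g i = Set.ncard {m : ℕ | i + 1 ≤ f m})
    (r : ℕ) (hr : r = Set.ncard {i : ℕ | i + 1 ≤ f i})
    (hfrob : ∀ i < r, f i = g i + 1)
    (s : ℕ) (hs : s < r) :
    (∑ i ∈ Finset.range s, f i) + 1 ≤ j + s * (s + 1) / 2 := by
  classical
  have hfs : s + 1 ≤ f s := by
    by_contra hc
    have hsub : {i : ℕ | i + 1 ≤ f i} ⊆ (Finset.range s : Set ℕ) := by
      intro i hi
      simp only [Set.mem_setOf_eq] at hi
      simp only [Finset.coe_range, Set.mem_Iio]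
      by_contra hle
      have := hanti (not_lt.mp hle)
      omega
    have := Set.ncard_le_ncard hsub (Finset.finite_toSet _)
    rw [Set.ncard_coe_finset, Finset.card_range] at this
    omega
  obtain ⟨M, hM⟩ := hfin.bddAbove
  have hz : ∀ m, M < m → f m = 0 := by
    intro m hm
    by_contra hne
    have : m ≤ M := hM (Function.mem_support.mpr hne)
    omega
  have hsM : s ≤ M := by
    by_contra hc
    have := hz s (by omega)
    omega
  obtain ⟨K, rfl⟩ : ∃ K, M = s + K := ⟨M - s, by omega⟩
  have hg' : ∀ i, g i = ∑ m ∈ Finset.range (s + (K + 1)), if i + 1 ≤ f m then 1 else 0 := by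
    intro i
    rw [hg, ← Finset.card_filter, ← Set.ncard_coe_finset]
    congr 1
    ext m
    simp only [Set.mem_setOf_eq, Finset.coe_filter, Finset.mem_range]
    constructor
    · intro h
      refine ⟨?_, h⟩
      by_contra hc
      have := hz m (by omega)
      omega
    · exact fun h => h.2
  have hmin : ∀ n : ℕ, (∑ i ∈ Finset.range s, if i + 1 ≤ n then 1 else 0) = min s n := by
    intro n
    rw [← Finset.card_filter]
    have : (Finset.range s).filter (fun i => i + 1 ≤ n) = Finset.range (min s n) := by
      ext i
      simp only [Finset.mem_filter, Finset.mem_range]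
      omega
    rw [this, Finset.card_range]
  have hB : ∑ i ∈ Finset.range s, g i = ∑ m ∈ Finset.range (s + (K + 1)), min s (f m) := by
    simp_rw [hg']
    rw [Finset.sum_comm]
    exact Finset.sum_congr rfl (fun m _ => hmin (f m))
  have hA : ∑ i ∈ Finset.range s, f i = ∑ i ∈ Finset.range s, g i + s := by
    rw [Finset.sum_congr rfl (fun i hi => hfrob i (by have := Finset.mem_range.mp hi; omega)),
      Finset.sum_add_distrib]
    simp
  have hT : ∑ i ∈ Finset.range (s + (K + 1)), f i = 2 * j := by
    rw [← hsum]
    refine (finsum_eq_sum_of_support_subset f ?_).symm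
    intro m hm
    have : m ≤ s + K := hM hm
    simp only [Finset.coe_range, Set.mem_Iio]
    omega
  rw [Finset.sum_range_add] at hB hT
  have h1 : ∑ m ∈ Finset.range s, min s (f m) = s * s := by
    rw [Finset.sum_congr rfl (g := fun _ => s)]
    · simp
    · intro m hm
      have := hanti (Finset.mem_range.mp hm).le
      omega
  have h2 : ∑ x ∈ Finset.range (K + 1), min s (f (s + x))
      < ∑ x ∈ Finset.range (K + 1), f (s + x) := by
    apply Finset.sum_lt_sum
    · intro i _
      exact min_le_right _ _
    · exact ⟨0, by simp, by simp only [Nat.add_zero]; omega⟩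
  have h3 : 2 * (s * (s + 1) / 2) = s * s + s := by
    rw [Nat.mul_div_cancel' (Nat.even_mul_succ_self s).two_dvd]
    ring
  omega
end

section
/- (Lemma 4.1, second part, combinatorial form.) Let λ be a partition of 2j with rank r which is of Frobenius type (μ₁+1,…,μ_r+1 | μ₁,…,μ_r), i.e. λᵢ = λ'ᵢ + 1 for all 1 ≤ i ≤ r. Then for every natural number s ≥ 0, ∑_{i=1}^{s} λᵢ ≤ j + s(s+1)/2. -/
/-- (Lemma 4.1, second part, combinatorial form.)  Let `λ` be a partition of `2j` with rank
`r` of Frobenius type `(μ₁+1,…,μ_r+1 | μ₁,…,μ_r)`, i.e. `λᵢ = λ'ᵢ + 1` for all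
`1 ≤ i ≤ r`.  Then for every natural number `s ≥ 0`, `∑_{i=1}^{s} λᵢ ≤ j + s(s+1)/2`.
The partition is encoded (0-indexed) as an antitone finitely supported `f : ℕ → ℕ`,
the conjugate by `g i = #{j : f j ≥ i + 1}`, the rank is `#{i : f i ≥ i + 1}`, and the
Frobenius condition reads `f i = g i + 1` for `i < r`. -/
theorem partial_sum_bound_symmetric_type (f : ℕ → ℕ) (hanti : Antitone f)
    (hfin : (Function.support f).Finite)
    (j : ℕ) (hsum : ∑ᶠ i, f i = 2 * j)
    (g : ℕ → ℕ) (hg : ∀ i, g i = Set.ncard {m : ℕ | i + 1 ≤ f m})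
    (r : ℕ) (hr : r = Set.ncard {i : ℕ | i + 1 ≤ f i})
    (hfrob : ∀ i < r, f i = g i + 1)
    (s : ℕ) :
    ∑ i ∈ Finset.range s, f i ≤ j + s * (s + 1) / 2 := by
  obtain ⟨M, hsM, hM⟩ : ∃ M, r ≤ M ∧ ∀ m, f m ≠ 0 → m < M := by
    obtain ⟨B, hB⟩ := hfin.bddAbove
    refine ⟨max r (B + 1), le_max_left _ _, fun m hm => ?_⟩
    have := hB (show m ∈ Function.support f from hm)
    omega
  have hN : ∑ i ∈ Finset.range M, f i = 2 * j := by
    rw [← hsum]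
    symm
    apply finsum_eq_sum_of_support_subset
    intro m hm
    simpa using hM m hm
  have hgc : ∀ i, g i = ∑ m ∈ Finset.range M, if i < f m then 1 else 0 := by
    intro i
    rw [hg, ← Finset.card_filter, ← Set.ncard_coe_finset]
    congr 1
    ext m
    simp only [Set.mem_setOf_eq, Finset.coe_filter, Finset.mem_range]
    constructor
    · intro h
      exact ⟨hM m (by omega), by omega⟩
    · intro h
      omega
  have hcol : ∀ s, ∑ i ∈ Finset.range s, g i = ∑ m ∈ Finset.range M, min (f m) s := by
    intro s
    simp only [hgc]
    rw [Finset.sum_comm]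
    refine Finset.sum_congr rfl fun m _ => ?_
    induction s with
    | zero => simp
    | succ k ih =>
      rw [Finset.sum_range_succ, ih]
      split_ifs <;> omega
  have key : ∀ s ≤ r, ∑ i ∈ Finset.range s, f i ≤ j + s * (s + 1) / 2 := by
    intro s hs
    have h1 : ∑ i ∈ Finset.range s, f i = ∑ i ∈ Finset.range s, g i + s := by
      rw [Finset.sum_congr rfl fun i hi => hfrob i (by have := Finset.mem_range.1 hi; omega)]
      simp [Finset.sum_add_distrib]
    have hle : s ≤ M := hs.trans hsM
    have h2 := Finset.sum_range_add_sum_Ico f hle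
    have h3 := Finset.sum_range_add_sum_Ico (fun m => min (f m) s) hle
    have h4 : ∑ m ∈ Finset.range s, min (f m) s ≤ s * s := by
      calc _ ≤ ∑ m ∈ Finset.range s, s := Finset.sum_le_sum fun m _ => min_le_right _ _
        _ = s * s := by simp
    have h5 : ∑ m ∈ Finset.Ico s M, min (f m) s ≤ ∑ m ∈ Finset.Ico s M, f m :=
      Finset.sum_le_sum fun m _ => min_le_left _ _
    have h6 := hcol s
    have h7 : s * (s + 1) = s * s + s := by ring
    omega
  have hdiag : ∀ s, r ≤ s → f s ≤ s := by
    intro s hs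
    by_contra hc
    have hsub : ((Finset.range (s + 1) : Finset ℕ) : Set ℕ) ⊆ {i : ℕ | i + 1 ≤ f i} := by
      intro i hi
      have hi' : i ≤ s := by
        have : i < s + 1 := by simpa using hi
        omega
      have := hanti hi'
      show i + 1 ≤ f i
      omega
    have hf : {i : ℕ | i + 1 ≤ f i}.Finite := hfin.subset fun i hi => by
      have : i + 1 ≤ f i := hi
      show f i ≠ 0
      omega
    have := Set.ncard_le_ncard hsub hf
    rw [Set.ncard_coe_finset, Finset.card_range] at this
    omega
  rcases le_total s r with h | h
  · exact key s h
  · induction s, h using Nat.le_induction with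
    | base => exact key r le_rfl
    | succ n hn ih =>
      rw [Finset.sum_range_succ]
      have h1 := hdiag n hn
      have h2 : (n + 1) * (n + 1 + 1) = n * (n + 1) + 2 * (n + 1) := by ring
      omega
end

section
/- (Proposition 2.2, combinatorial inversion bound.) Let k ≥ 1, let r₁,…,r_{k+1} be positive integers with n = r₁+⋯+r_{k+1}, and let l ≥ 1. Let a₁,…,a_k be integers with aᵢ − a_{i+1} ≥ l for 1 ≤ i ≤ k−1 and a_k ≥ l, and set a_{k+1} = 0. For each 1 ≤ i ≤ k+1 let αᵢ = (a_{i1} ≥ a_{i2} ≥ ⋯ ≥ a_{i rᵢ} ≥ 0) be a partition of length rᵢ. Let α̃ be the integer sequence of length n obtained by concatenating the blocks (a_{i1}+aᵢ, …, a_{i rᵢ}+aᵢ) for i = 1,…,k+1, and let α̃' be the sequence whose t-th entry is the t-th entry of α̃ minus t. If the entries of α̃' are pairwise distinct, then there exist natural numbers sᵢ with 0 ≤ sᵢ ≤ rᵢ for 2 ≤ i ≤ k+1 such that the number of inversions of α̃' satisfies inv(α̃') ≤ ∑_{p=2}^{k+1} ∑_{i=1}^{s_p} a_{p i} − l·(s₂+⋯+s_{k+1})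 − ∑_{p=2}^{k+1} s_p². -/
/-- (Proposition 2.2, combinatorial inversion bound.)  Let `k ≥ 1`, let `r₁,…,r_{k+1}` be
positive integers, and let `l ≥ 1`.  Let `a₁,…,a_k` be integers with `aᵢ − a_{i+1} ≥ l`
for `1 ≤ i ≤ k−1` and `a_k ≥ l`, and set `a_{k+1} = 0`.  For each `1 ≤ p ≤ k+1` let
`α_p = (a_{p1} ≥ ⋯ ≥ a_{p r_p} ≥ 0)` be a partition of length `r_p`.  Let `α̃` be the
sequence of length `n = r₁+⋯+r_{k+1}` obtained by concatenating the blocks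
`(a_{p1}+a_p, …, a_{p r_p}+a_p)`, and let `α̃'` be obtained by subtracting `t` from the
`t`-th entry.  If the entries of `α̃'` are pairwise distinct, then there exist
`0 ≤ s_p ≤ r_p` for `2 ≤ p ≤ k+1` such that the number of inversions of `α̃'` satisfies
`inv(α̃') ≤ ∑_{p=2}^{k+1} ∑_{i=1}^{s_p} a_{p i} − l·(s₂+⋯+s_{k+1}) − ∑_{p=2}^{k+1} s_p²`.

Encoding: blocks are indexed by `p : Fin (k+1)` (so `p = 0` is the first block and the
condition `2 ≤ p` becomes `s 0 = 0`), the entries of `α_p` by `Fin (r p)` (0-indexed),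
positions in the concatenated sequence by `pos`, the shifted sequence by `tilde`, and an
inversion is a pair of indices `(u, v)` with `pos u < pos v` and `tilde u < tilde v`. -/
theorem inversion_bound (k : ℕ) (hk : 1 ≤ k)
    (r : Fin (k + 1) → ℕ) (hr : ∀ p, 1 ≤ r p)
    (l : ℤ) (hl : 1 ≤ l)
    (a : Fin (k + 1) → ℤ)
    (ha : ∀ i : Fin k, l ≤ a i.castSucc - a i.succ)
    (halast : a (Fin.last k) = 0)
    (A : (p : Fin (k + 1)) → ℕ → ℕ)
    (hA : ∀ p, ∀ i j : ℕ, i ≤ j → j < r p → A p j ≤ A p i)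
    (pos : (Σ p : Fin (k + 1), Fin (r p)) → ℕ)
    (hpos : ∀ x : Σ p : Fin (k + 1), Fin (r p),
      pos x = (∑ q ∈ Finset.univ.filter (fun q => q < x.1), r q) + (x.2 : ℕ))
    (tilde : (Σ p : Fin (k + 1), Fin (r p)) → ℤ)
    (htilde : ∀ x : Σ p : Fin (k + 1), Fin (r p),
      tilde x = (A x.1 (x.2 : ℕ) : ℤ) + a x.1 - ((pos x : ℤ) + 1))
    (hdist : Function.Injective tilde) :
    ∃ s : Fin (k + 1) → ℕ, s 0 = 0 ∧ (∀ p, s p ≤ r p) ∧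
      ((Finset.univ.filter
          (fun y : (Σ p : Fin (k + 1), Fin (r p)) × (Σ p : Fin (k + 1), Fin (r p)) =>
            pos y.1 < pos y.2 ∧ tilde y.1 < tilde y.2)).card : ℤ)
        ≤ (∑ p, ∑ i ∈ Finset.range (s p), (A p i : ℤ))
            - l * (∑ p, (s p : ℤ)) - ∑ p, (s p : ℤ) ^ 2 := by
  classical
  -- block starts
  obtain ⟨S, hS⟩ : ∃ S : Fin (k + 1) → ℕ,
      ∀ p, S p = ∑ q ∈ Finset.univ.filter (fun q => q < p), r q := ⟨_, fun _ => rfl⟩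
  have hSlt : ∀ p q, p < q → S p + r p ≤ S q := by
    intro p q hpq
    rw [hS, hS, add_comm, ← Finset.sum_insert (by simp)]
    apply Finset.sum_le_sum_of_subset
    intro x hx
    simp only [Finset.mem_insert, Finset.mem_filter, Finset.mem_univ, true_and] at hx ⊢
    rcases hx with rfl | hx
    · exact hpq
    · exact hx.trans hpq
  have hpos' : ∀ x, pos x = S x.1 + (x.2 : ℕ) := fun x => by rw [hpos, hS]
  have hanti : Antitone a := by
    rw [Fin.antitone_iff_succ_le]
    intro i
    have := ha i
    linarith
  have hgap : ∀ q p, q < p → a p + l ≤ a q := by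
    intro q p hqp
    obtain ⟨m, rfl⟩ := Fin.exists_succ_eq.mpr (Fin.ne_zero_of_lt hqp)
    have h1 : a m.castSucc ≤ a q := hanti (by
      rw [Fin.le_def]; rw [Fin.lt_def] at hqp; simp at hqp ⊢; omega)
    have := ha m
    linarith
  -- the values within block p
  let B : Fin (k + 1) → ℕ → ℤ := fun p j => (A p j : ℤ) + a p - ((S p : ℤ) + j + 1)
  have hB : ∀ x, tilde x = B x.1 x.2 := by
    intro x
    simp only [B]
    rw [htilde, hpos']
    push_cast
    ring
  have hBlt : ∀ p i j, i < j → j < r p → B p j < B p i := by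
    intro p i j hij hj
    have := hA p i j hij.le hj
    simp only [B]
    omega
  let F : (Σ p : Fin (k + 1), Fin (r p)) → Finset (Σ p : Fin (k + 1), Fin (r p)) :=
    fun y => Finset.univ.filter (fun x => pos x < pos y ∧ tilde x < tilde y)
  have hF : ∀ x y, x ∈ F y ↔ (pos x < pos y ∧ tilde x < tilde y) := by
    intro x y; simp [F]
  have hFblock : ∀ x y, x ∈ F y → x.1 < y.1 := by
    intro x y hx
    obtain ⟨h1, h2⟩ := (hF x y).1 hx
    rw [hpos', hpos'] at h1
    by_contra hcon
    rcases lt_or_eq_of_le (not_lt.1 hcon) with h | h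
    · have := hSlt _ _ h
      have := y.2.2
      omega
    · obtain ⟨p, i⟩ := x
      obtain ⟨q, j⟩ := y
      simp only at h
      subst h
      rw [hB, hB] at h2
      have := hBlt q i j (by simpa using h1) j.2
      simp only at h2
      omega
  have hFlow : ∀ x y, x ∈ F y → a y.1 + l - S y.1 ≤ tilde x := by
    intro x y hx
    have h := hFblock x y hx
    have h1 := hgap _ _ h
    have h2 := hSlt _ _ h
    have h3 := x.2.2
    rw [hB]
    simp only [B]
    omega
  have key : ∀ p : Fin (k + 1), ∃ s : ℕ, (p = 0 → s = 0) ∧ s ≤ r p ∧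
      ((∑ i : Fin (r p), (F ⟨p, i⟩).card : ℕ) : ℤ) ≤
        (∑ i ∈ Finset.range s, (A p i : ℤ)) - l * s - (s : ℤ) ^ 2 := by
    intro p
    let N : ℕ → ℕ := fun i => if h : i < r p then (F ⟨p, ⟨i, h⟩⟩).card else 0
    have hNsum : ∑ i : Fin (r p), (F ⟨p, i⟩).card = ∑ i ∈ Finset.range (r p), N i := by
      rw [← Fin.sum_univ_eq_sum_range]
      apply Finset.sum_congr rfl
      intro i _
      simp [N]
    have hex : ∃ i, N i = 0 := ⟨r p, by simp [N]⟩
    let s := Nat.find hex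
    have hs0 : N s = 0 := Nat.find_spec hex
    have hsr : s ≤ r p := Nat.find_min' hex (by simp [N])
    have hsmin : ∀ i, i < s → N i ≠ 0 := fun i hi => Nat.find_min hex hi
    have hpre : ∀ j, j < s → a p + l - S p ≤ B p j - 1 := by
      intro j hj
      have h1 := hsmin j hj
      have hjr : j < r p := by omega
      simp only [N, hjr, dif_pos] at h1
      obtain ⟨x, hx⟩ := Finset.card_ne_zero.1 h1
      have h2 := hFlow _ _ hx
      have h3 := ((hF _ _).1 hx).2
      rw [hB ⟨p, ⟨j, hjr⟩⟩] at h3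
      simp only at h2 h3
      omega
    have hpost : ∀ i, s ≤ i → N i = 0 := by
      intro i hi
      by_cases hir : i < r p
      · have hsr' : s < r p := by omega
        simp only [N, hir, hsr', dif_pos, Finset.card_eq_zero] at hs0 ⊢
        rw [Finset.eq_empty_iff_forall_notMem] at hs0 ⊢
        intro x hx
        apply hs0 x
        have hb := hFblock _ _ hx
        have h3 := ((hF _ _).1 hx).2
        rw [hF]
        constructor
        · rw [hpos', hpos']
          have := hSlt _ _ hb
          have := x.2.2
          simp only at *
          omega
        · rw [hB ⟨p, ⟨i, hir⟩⟩] at h3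
          rw [hB ⟨p, ⟨s, hsr'⟩⟩]
          simp only at h3 ⊢
          rcases hi.eq_or_lt with h | h
          · rw [h]; exact h3
          · have := hBlt p s i h hir
            omega
      · simp [N, hir]
    have hbound : ∀ i, i < s → (N i : ℤ) ≤ (A p i : ℤ) - l - s := by
      intro i hi
      have hir : i < r p := by omega
      have hsub : (F ⟨p, ⟨i, hir⟩⟩).image tilde ∪ (Finset.Ioo i s).image (B p) ⊆
          Finset.Ico (a p + l - S p) (B p i) := by
        intro z hz
        rw [Finset.mem_union, Finset.mem_image, Finset.mem_image] at hz
        rw [Finset.mem_Ico]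
        rcases hz with ⟨x, hx, rfl⟩ | ⟨j, hj, rfl⟩
        · refine ⟨hFlow _ _ hx, ?_⟩
          have := ((hF _ _).1 hx).2
          rwa [hB ⟨p, ⟨i, hir⟩⟩] at this
        · rw [Finset.mem_Ioo] at hj
          refine ⟨?_, hBlt p i j hj.1 (by omega)⟩
          have := hpre j hj.2
          omega
      have hdisj : Disjoint ((F ⟨p, ⟨i, hir⟩⟩).image tilde) ((Finset.Ioo i s).image (B p)) := by
        rw [Finset.disjoint_left]
        intro z hz hz'
        obtain ⟨x, hx, rfl⟩ := Finset.mem_image.1 hz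
        obtain ⟨j, hj, hjx⟩ := Finset.mem_image.1 hz'
        rw [Finset.mem_Ioo] at hj
        have hjr : j < r p := by omega
        have : tilde ⟨p, ⟨j, hjr⟩⟩ = tilde x := by rw [hB]; exact hjx
        have h1 := hdist this
        have h2 := hFblock _ _ hx
        rw [← h1] at h2
        exact lt_irrefl _ h2
      have hcard := Finset.card_le_card hsub
      rw [Finset.card_union_of_disjoint hdisj, Finset.card_image_of_injective _ hdist,
        Finset.card_image_of_injOn, Nat.card_Ioo, Int.card_Ico] at hcard
      · have h1 := hpre i hi
        simp only [N, hir, dif_pos]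
        simp only [B] at hcard h1
        omega
      · intro j hj j' hj' h
        simp only [Finset.coe_Ioo, Set.mem_Ioo] at hj hj'
        rcases lt_trichotomy j j' with h' | h' | h'
        · have := hBlt p j j' h' (by omega)
          omega
        · exact h'
        · have := hBlt p j' j h' (by omega)
          omega
    refine ⟨s, ?_, hsr, ?_⟩
    · rintro rfl
      by_contra hne
      have h1 := hsmin 0 (by omega)
      have h0 : 0 < r 0 := hr 0
      simp only [N, h0, dif_pos] at h1
      obtain ⟨x, hx⟩ := Finset.card_ne_zero.1 h1
      exact absurd (hFblock _ _ hx) (Fin.not_lt_zero _)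
    · rw [hNsum]
      have : ∑ i ∈ Finset.range (r p), N i = ∑ i ∈ Finset.range s, N i := by
        symm
        apply Finset.sum_subset
        · intro i; simp only [Finset.mem_range]; omega
        · intro i _ h
          exact hpost i (by simpa using h)
      rw [this]
      push_cast
      calc ∑ i ∈ Finset.range s, (N i : ℤ)
          ≤ ∑ i ∈ Finset.range s, ((A p i : ℤ) - l - s) :=
            Finset.sum_le_sum fun i hi => hbound i (Finset.mem_range.1 hi)
        _ = _ := by
            simp only [Finset.sum_sub_distrib, Finset.sum_const, Finset.card_range, nsmul_eq_mul]
            ring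
  choose s hs0 hsr hs using key
  refine ⟨s, hs0 0 rfl, hsr, ?_⟩
  have hcount : (Finset.univ.filter
          (fun y : (Σ p : Fin (k + 1), Fin (r p)) × (Σ p : Fin (k + 1), Fin (r p)) =>
            pos y.1 < pos y.2 ∧ tilde y.1 < tilde y.2)).card
      = ∑ p, ∑ i : Fin (r p), (F ⟨p, i⟩).card := by
    rw [← Fintype.sum_sigma (fun y => (F y).card), Finset.card_filter, Fintype.sum_prod_type_right]
    apply Finset.sum_congr rfl
    intro y _
    simp only [F, Finset.card_filter]
  rw [hcount, Finset.mul_sum, ← Finset.sum_sub_distrib, ← Finset.sum_sub_distrib, Nat.cast_sum]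
  exact Finset.sum_le_sum fun p _ => hs p
end
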